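/- Positive semidefiniteness of the distributed-minus-centralized covariance gap: Let Γ ∈ ℝ^{M×M} be a symmetric positive definite matrix, let N ≥ 1 be an integer, and let a > 1/(2·λ_min(Γ)), where λ_min(Γ) is the minimum eigenvalue of Γ. Then the matrix (a/(2N))·I + (1/(4N))·(Γ − I/(2a))^{−1} − (1/N)·Γ^{−1} is positive semidefinite. -/

import Mathlib

open Matrix

noncomputable section

/-- The minimum eigenvalue of a square real matrix. -/
noncomputable def minEig {M : ℕ} (A : Matrix (Fin M) (Fin M) ℝ) : ℝ :=
  sInf {r : ℝ | Module.End.HasEigenvalue (Matrix.toLin' A) r}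

theorem finite_setOf_hasEigenvalue {M : ℕ} (A : Matrix (Fin M) (Fin M) ℝ) :
    {r : ℝ | Module.End.HasEigenvalue (Matrix.toLin' A) r}.Finite :=
  Module.End.finite_hasEigenvalue _

theorem minEig_le {M : ℕ} {A : Matrix (Fin M) (Fin M) ℝ} {r : ℝ}
    (hr : Module.End.HasEigenvalue (Matrix.toLin' A) r) : minEig A ≤ r :=
  csInf_le (finite_setOf_hasEigenvalue A).bddBelow hr

theorem Matrix.IsHermitian.hasEigenvalue_add_eigenvalues_sub_smul_one {M : ℕ}
    {A : Matrix (Fin M) (Fin M) ℝ} {c : ℝ} (hA : (A - c • 1).IsHermitian) (i : Fin M) :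
    Module.End.HasEigenvalue (Matrix.toLin' A) (hA.eigenvalues i + c) := by
  have hv := hA.mulVec_eigenvectorBasis i
  refine Module.End.hasEigenvalue_of_hasEigenvector
    (x := (hA.eigenvectorBasis i).ofLp) ⟨?_, ?_⟩
  · rw [Module.End.mem_eigenspace_iff, Matrix.toLin'_apply, add_smul, ← hv, sub_mulVec,
      smul_mulVec, one_mulVec, sub_add_cancel]
  · intro h
    apply hA.eigenvectorBasis.orthonormal.ne_zero i
    ext j
    exact congrFun h j

theorem Matrix.PosDef.minEig_pos {M : ℕ} [NeZero M] {A : Matrix (Fin M) (Fin M) ℝ}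
    (hA : A.PosDef) : 0 < minEig A := by
  have hne : {r : ℝ | Module.End.HasEigenvalue (Matrix.toLin' A) r}.Nonempty := by
    have h : (A - (0 : ℝ) • 1).IsHermitian := by simpa using hA.isHermitian
    exact ⟨_, h.hasEigenvalue_add_eigenvalues_sub_smul_one 0⟩
  obtain ⟨v, hv⟩ := (hne.csInf_mem (finite_setOf_hasEigenvalue A)).exists_hasEigenvector
  have hpos := hA.dotProduct_mulVec_pos hv.2
  have hAv : A *ᵥ v = minEig A • v := hv.apply_eq_smul
  rw [hAv, dotProduct_smul, smul_eq_mul] at hpos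
  exact pos_of_mul_pos_left hpos (dotProduct_star_self_nonneg v)

theorem Matrix.IsHermitian.posDef_sub_smul_one {M : ℕ} {A : Matrix (Fin M) (Fin M) ℝ}
    (hA : A.IsHermitian) {c : ℝ} (hc : c < minEig A) : (A - c • 1).PosDef := by
  have hB : (A - c • 1).IsHermitian := hA.sub (isHermitian_one.smul (IsSelfAdjoint.all c))
  rw [hB.posDef_iff_eigenvalues_pos]
  intro i
  linarith [minEig_le (hB.hasEigenvalue_add_eigenvalues_sub_smul_one i)]

/-- The scalar identity behind this is
`1 / c + 1 / b - 4 / (b + c) = (b - c) ^ 2 / (c * b * (b + c))`. -/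
theorem Matrix.PosDef.posSemidef_inv_add_inv_sub {M : ℕ} {B : Matrix (Fin M) (Fin M) ℝ}
    (hB : B.PosDef) {c : ℝ} (hc : 0 < c) :
    (c⁻¹ • (1 : Matrix (Fin M) (Fin M) ℝ) + B⁻¹ - (4 : ℝ) • (B + c • 1)⁻¹).PosSemidef := by
  have hG : (B + c • 1).PosDef := hB.add (PosDef.one.smul hc)
  have hBG : (B * (B + c • 1)).PosDef := by
    have hsq : (B * B).PosSemidef := by
      simpa only [hB.isHermitian.eq] using posSemidef_conjTranspose_mul_self B
    simpa [mul_add] using (hB.smul hc).posSemidef_add hsq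
  have hD : (B - c • 1).IsHermitian :=
    hB.isHermitian.sub (isHermitian_one.smul (IsSelfAdjoint.all c))
  have hP := (hBG.inv.posSemidef.conjTranspose_mul_mul_same (B - c • 1)).smul
    (inv_nonneg.2 hc.le)
  rw [hD.eq] at hP
  convert! hP using 1
  have hBu := (isUnit_iff_isUnit_det B).1 hB.isUnit
  have hGu := (isUnit_iff_isUnit_det (B + c • 1)).1 hG.isUnit
  have hleft : (B - c • 1) * (B + c • 1)⁻¹ = 1 - (2 * c) • (B + c • 1)⁻¹ := by
    rw [show B - c • 1 = (B + c • 1) - (2 * c) • (1 : Matrix (Fin M) (Fin M) ℝ) by module,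
      sub_mul, mul_nonsing_inv _ hGu, smul_mul_assoc, one_mul]
  have hright : B⁻¹ * (B - c • 1) = 1 - c • B⁻¹ := by
    rw [mul_sub, nonsing_inv_mul _ hBu, mul_smul_comm, mul_one]
  have hres : c • ((B + c • 1)⁻¹ * B⁻¹) = B⁻¹ - (B + c • 1)⁻¹ := by
    calc c • ((B + c • 1)⁻¹ * B⁻¹) = (B + c • 1)⁻¹ * ((B + c • 1) - B) * B⁻¹ := by
          simp
      _ = B⁻¹ - (B + c • 1)⁻¹ := by
          rw [mul_sub, nonsing_inv_mul _ hGu, sub_mul, one_mul, mul_assoc,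
            mul_nonsing_inv _ hBu, mul_one]
  have hprod : (B - c • 1) * (B * (B + c • 1))⁻¹ * (B - c • 1)
      = 1 + c • B⁻¹ - (4 * c) • (B + c • 1)⁻¹ := by
    rw [mul_inv_rev, ← mul_assoc, hleft, mul_assoc, hright, mul_sub, mul_one, mul_smul_comm,
      sub_mul, one_mul, smul_mul_assoc, smul_sub, smul_comm c, hres]
    module
  rw [hprod, smul_sub, smul_add, smul_smul, smul_smul, inv_mul_cancel₀ hc.ne', one_smul,
    show c⁻¹ * (4 * c) = 4 by field_simp]

/-- **Positive semidefiniteness of the distributed-minus-centralized covariance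
gap**: for a symmetric positive definite `Γ`, an integer `N ≥ 1` and
`a > 1/(2 λ_min(Γ))`, the matrix
`(a/(2N))·I + (1/(4N))·(Γ − I/(2a))⁻¹ − (1/N)·Γ⁻¹` is positive semidefinite. -/
theorem covariance_gap_posSemidef {M : ℕ} (N : ℕ) (hN : 1 ≤ N)
    (Γ : Matrix (Fin M) (Fin M) ℝ) (hΓ : Γ.PosDef)
    (a : ℝ) (ha : a > 1 / (2 * minEig Γ)) :
    Matrix.PosSemidef
      ((a / (2 * (N : ℝ))) • (1 : Matrix (Fin M) (Fin M) ℝ)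
        + (1 / (4 * (N : ℝ))) • (Γ - (2 * a)⁻¹ • 1)⁻¹
        - (N : ℝ)⁻¹ • Γ⁻¹) := by
  obtain rfl | hM := eq_or_ne M 0
  · rw [Subsingleton.elim (_ - _) (0 : Matrix (Fin 0) (Fin 0) ℝ)]
    exact .zero
  have : NeZero M := ⟨hM⟩
  have hm := hΓ.minEig_pos
  have ha0 : 0 < a := lt_trans (by positivity) ha
  have hc : (2 * a)⁻¹ < minEig Γ := by
    rw [gt_iff_lt, div_lt_iff₀ (by positivity)] at ha
    rw [inv_lt_iff_one_lt_mul₀ (by positivity)]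
    linarith
  have hgap := ((hΓ.isHermitian.posDef_sub_smul_one hc).posSemidef_inv_add_inv_sub
    (show 0 < (2 * a)⁻¹ by positivity)).smul (show 0 ≤ 1 / (4 * (N : ℝ)) by positivity)
  rw [sub_add_cancel] at hgap
  convert hgap using 1
  have hN0 : (N : ℝ) ≠ 0 := by positivity
  rw [smul_sub, smul_add, smul_smul, smul_smul]
  congr 3 <;> field_simp
  norm_num
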